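/- Let ρ be a symmetric probability measure on ℝ which is not the Dirac mass at 0 and which has a finite fifth moment; let σ² be its variance and μ₄ its fourth moment. Let Zₙ = ∫_{ℝⁿ} exp( (1/2)·(x₁+⋯+xₙ)²/(x₁²+⋯+xₙ²) )·1{x₁²+⋯+xₙ² > 0} dρ(x₁)⋯dρ(xₙ) be the normalization constant of μ̃_{n,ρ}. Then √(2π)·Zₙ/n^{1/4} → ∫_ℝ exp(−μ₄ z⁴/(12σ⁴)) dz as n → ∞; equivalently, Zₙ ~ n^{1/4}·(2π)^{−1/2}·(3σ⁴/(4μ₄))^{1/4}·Γ(1/4). -/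

import Mathlib

open MeasureTheory Filter Topology Real

/-- `Sₙ(x) = x₁ + ⋯ + xₙ`. -/
noncomputable def S (n : ℕ) (x : Fin n → ℝ) : ℝ := ∑ i, x i

/-- `Tₙ(x) = x₁² + ⋯ + xₙ²`. -/
noncomputable def T (n : ℕ) (x : Fin n → ℝ) : ℝ := ∑ i, (x i) ^ 2

/-- The (unnormalized) density `exp((1/2) Sₙ²/Tₙ) 1{Tₙ > 0}` of the Curie-Weiss model
of SOC with respect to `ρ^⊗n`. -/
noncomputable def weight (n : ℕ) (x : Fin n → ℝ) : ℝ :=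
  if 0 < T n x then Real.exp (S n x ^ 2 / (2 * T n x)) else 0

/-- The normalization constant `Zₙ = ∫ exp((1/2) Sₙ²/Tₙ) 1{Tₙ > 0} dρ⊗ⁿ`. -/
noncomputable def Z (ρ : Measure ℝ) (n : ℕ) : ℝ :=
  ∫ x, weight n x ∂(Measure.pi fun _ : Fin n => ρ)

/-- A function vanishing at `0` with nonnegative derivative on `[0, ∞)` is nonnegative there. -/
lemma nonneg_of_hasDerivAt_nonneg {f f' : ℝ → ℝ} (h0 : f 0 = 0)
    (hf : ∀ x, HasDerivAt f (f' x) x) (hf' : ∀ x, 0 ≤ x → 0 ≤ f' x) {y : ℝ} (hy : 0 ≤ y) :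
    0 ≤ f y := by
  have hmono : MonotoneOn f (Set.Ici 0) := by
    apply monotoneOn_of_deriv_nonneg (convex_Ici 0)
    · exact fun x _ => (hf x).continuousAt.continuousWithinAt
    · exact fun x _ => (hf x).differentiableAt.differentiableWithinAt
    · intro x hx
      rw [interior_Ici] at hx
      rw [(hf x).deriv]
      exact hf' x (le_of_lt hx)
  have := hmono (Set.mem_Ici.2 le_rfl) (Set.mem_Ici.2 hy) hy
  rwa [h0] at this

lemma sinh_le_mul_cosh {y : ℝ} (hy : 0 ≤ y) : 0 ≤ y * cosh y - sinh y := by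
  refine nonneg_of_hasDerivAt_nonneg (f := fun y => y * cosh y - sinh y)
    (f' := fun y => y * sinh y) (by simp) (fun x => ?_)
    (fun x hx => mul_nonneg hx (sinh_nonneg_iff.2 hx)) hy
  refine HasDerivAt.congr_deriv (((hasDerivAt_id x).mul (hasDerivAt_cosh x)).sub (hasDerivAt_sinh x)) ?_
  simp

/-- Padé lower bound for `tanh`. -/
lemma three_mul_cosh_le {y : ℝ} (hy : 0 ≤ y) : 0 ≤ (3 + y ^ 2) * sinh y - 3 * y * cosh y := by
  refine nonneg_of_hasDerivAt_nonneg (f := fun y => (3 + y ^ 2) * sinh y - 3 * y * cosh y)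
    (f' := fun y => y * (y * cosh y - sinh y)) (by simp) (fun x => ?_)
    (fun x hx => mul_nonneg hx (sinh_le_mul_cosh hx)) hy
  refine HasDerivAt.congr_deriv (((((hasDerivAt_id x).pow 2).const_add 3).mul (hasDerivAt_sinh x)).sub
    (((hasDerivAt_id x).const_mul 3).mul (hasDerivAt_cosh x))) ?_
  simp
  ring

/-- Padé upper bound for `tanh`. -/
lemma sinh_le_pade {y : ℝ} (hy : 0 ≤ y) :
    0 ≤ (15 * y + y ^ 3) * cosh y - (15 + 6 * y ^ 2) * sinh y := by
  refine nonneg_of_hasDerivAt_nonneg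
    (f := fun y => (15 * y + y ^ 3) * cosh y - (15 + 6 * y ^ 2) * sinh y)
    (f' := fun y => y * ((3 + y ^ 2) * sinh y - 3 * y * cosh y)) (by simp) (fun x => ?_)
    (fun x hx => mul_nonneg hx (three_mul_cosh_le hx)) hy
  refine HasDerivAt.congr_deriv (((((hasDerivAt_id x).const_mul 15).add ((hasDerivAt_id x).pow 3)).mul
    (hasDerivAt_cosh x)).sub
    (((((hasDerivAt_id x).pow 2).const_mul 6).const_add 15).mul (hasDerivAt_sinh x))) ?_
  simp
  ring

/-- The gap `y² / 2 - log (cosh y)` in the sub-Gaussian bound `cosh y ≤ exp (y² / 2)`. -/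
noncomputable def coshGap (y : ℝ) : ℝ := y ^ 2 / 2 - Real.log (cosh y)

lemma coshGap_neg (y : ℝ) : coshGap (-y) = coshGap y := by simp [coshGap]

lemma coshGap_abs (y : ℝ) : coshGap |y| = coshGap y := by
  rcases abs_choice y with h | h <;> simp [h, coshGap_neg]

lemma exp_neg_coshGap (y : ℝ) : Real.exp (-coshGap y) = Real.exp (-(y ^ 2 / 2)) * cosh y := by
  rw [coshGap, neg_sub, sub_eq_neg_add, Real.exp_add, Real.exp_log (cosh_pos y)]

lemma hasDerivAt_coshGap (y : ℝ) : HasDerivAt coshGap (y - sinh y / cosh y) y := by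
  unfold coshGap
  refine HasDerivAt.congr_deriv ((((hasDerivAt_id y).pow 2).div_const 2).sub
    ((hasDerivAt_cosh y).log (cosh_pos y).ne')) ?_
  simp

lemma continuous_coshGap : Continuous coshGap :=
  continuous_iff_continuousAt.2 fun y => (hasDerivAt_coshGap y).continuousAt

lemma coshGap_zero : coshGap 0 = 0 := by simp [coshGap]

lemma coshGap_le (y : ℝ) : coshGap y ≤ y ^ 4 / 12 := by
  have key : 0 ≤ |y| ^ 4 / 12 - coshGap |y| := by
    refine nonneg_of_hasDerivAt_nonneg (f := fun y => y ^ 4 / 12 - coshGap y)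
      (f' := fun y => y ^ 3 / 3 - (y - sinh y / cosh y)) (by simp [coshGap_zero])
      (fun x => ?_) (fun x hx => ?_) (abs_nonneg y)
    · refine HasDerivAt.congr_deriv ((((hasDerivAt_id x).pow 4).div_const 12).sub (hasDerivAt_coshGap x)) ?_
      simp
      ring
    · have hc := cosh_pos x
      have h := three_mul_cosh_le hx
      have h1 : 3 * x / (3 + x ^ 2) ≤ sinh x / cosh x := by
        rw [div_le_div_iff₀ (by positivity) hc]
        linarith
      have h2 : x - x ^ 3 / 3 ≤ 3 * x / (3 + x ^ 2) := by
        rw [le_div_iff₀ (by positivity)]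
        nlinarith [pow_nonneg hx 5]
      linarith
  rw [coshGap_abs] at key
  have : |y| ^ 4 = y ^ 4 := Even.pow_abs (by decide) y
  linarith

lemma le_coshGap (y : ℝ) : y ^ 4 / (12 * (1 + y ^ 2)) ≤ coshGap y := by
  have key : 0 ≤ coshGap |y| - |y| ^ 4 / (12 * (1 + |y| ^ 2)) := by
    refine nonneg_of_hasDerivAt_nonneg (f := fun y => coshGap y - y ^ 4 / (12 * (1 + y ^ 2)))
      (f' := fun y => (y - sinh y / cosh y) - (2 * y ^ 3 + y ^ 5) / (6 * (1 + y ^ 2) ^ 2))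
      (by simp [coshGap_zero])
      (fun x => ?_) (fun x hx => ?_) (abs_nonneg y)
    · have hne : (12 * (1 + x ^ 2)) ≠ 0 := by positivity
      refine HasDerivAt.congr_deriv ((hasDerivAt_coshGap x).sub (((hasDerivAt_id x).pow 4).div
        ((((hasDerivAt_id x).pow 2).const_add 1).const_mul 12) hne)) ?_
      simp
      field_simp
      ring
    · have hc := cosh_pos x
      have h := sinh_le_pade hx
      have h1 : sinh x / cosh x ≤ (15 * x + x ^ 3) / (15 + 6 * x ^ 2) := by
        rw [div_le_div_iff₀ hc (by positivity)]
        linarith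
      have h2 : (2 * x ^ 3 + x ^ 5) / (6 * (1 + x ^ 2) ^ 2)
          ≤ x - (15 * x + x ^ 3) / (15 + 6 * x ^ 2) := by
        have : x - (15 * x + x ^ 3) / (15 + 6 * x ^ 2) = 5 * x ^ 3 / (15 + 6 * x ^ 2) := by
          field_simp
          ring
        rw [this, div_le_div_iff₀ (by positivity) (by positivity)]
        nlinarith [pow_nonneg hx 3, pow_nonneg hx 5, pow_nonneg hx 7]
      linarith
  rw [coshGap_abs] at key
  have h4 : |y| ^ 4 = y ^ 4 := Even.pow_abs (by decide) y
  rw [h4, sq_abs] at key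
  linarith

lemma sub_le_coshGap (y : ℝ) : y ^ 4 / 12 - |y| ^ 5 / 24 ≤ coshGap y := by
  refine le_trans ?_ (le_coshGap y)
  have h4 : |y| ^ 4 = y ^ 4 := Even.pow_abs (by decide) y
  rw [← h4, ← sq_abs y]
  have ha := abs_nonneg y
  rw [le_div_iff₀ (by positivity)]
  nlinarith [mul_nonneg (pow_nonneg ha 5) (sq_nonneg (1 - |y|))]

/-- Convexity lower bound: the total gap is controlled by the sum of squares. -/
lemma le_sum_coshGap {n : ℕ} (a : Fin n → ℝ) :
    (∑ i, a i ^ 2) ^ 2 / (12 * (n + ∑ i, a i ^ 2)) ≤ ∑ i, coshGap (a i) := by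
  calc (∑ i, a i ^ 2) ^ 2 / (12 * (n + ∑ i, a i ^ 2))
      = (∑ i, a i ^ 2) ^ 2 / ∑ i, 12 * (1 + a i ^ 2) := by
        rw [← Finset.mul_sum, Finset.sum_add_distrib]
        simp
    _ ≤ ∑ i, (a i ^ 2) ^ 2 / (12 * (1 + a i ^ 2)) :=
        Finset.sq_sum_div_le_sum_sq_div _ _ fun i _ => by positivity
    _ ≤ ∑ i, coshGap (a i) := Finset.sum_le_sum fun i _ => by
        rw [← pow_mul]
        exact le_coshGap (a i)

lemma neg_sq_add_mul_eq (a u : ℝ) :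
    Real.exp (-(u ^ 2 / 2) + u * a) = Real.exp (a ^ 2 / 2) * Real.exp (-(1 / 2) * (u - a) ^ 2) := by
  rw [← Real.exp_add]
  ring_nf

lemma integrable_exp_neg_sq_add_mul (a : ℝ) :
    Integrable fun u : ℝ => Real.exp (-(u ^ 2 / 2) + u * a) := by
  simp_rw [neg_sq_add_mul_eq]
  exact ((integrable_exp_neg_mul_sq (by norm_num : (0 : ℝ) < 1 / 2)).comp_sub_right a).const_mul _

/-- Hubbard–Stratonovich linearization of `exp (a² / 2)`. -/
lemma integral_exp_neg_sq_add_mul (a : ℝ) :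
    ∫ u : ℝ, Real.exp (-(u ^ 2 / 2) + u * a) = √(2 * π) * Real.exp (a ^ 2 / 2) := by
  simp_rw [neg_sq_add_mul_eq]
  rw [integral_const_mul, integral_sub_right_eq_self (fun u : ℝ => Real.exp (-(1 / 2) * u ^ 2)),
    integral_gaussian, mul_comm]
  congr 2
  ring

/-- The sign `±1` attached to a Boolean. -/
noncomputable def boolSign (b : Bool) : ℝ := if b then 1 else -1

lemma boolSign_sq (b : Bool) : boolSign b ^ 2 = 1 := by cases b <;> simp [boolSign]

lemma prod_cosh_eq {n : ℕ} (x : Fin n → ℝ) :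
    ∏ i, cosh (x i) =
      (1 / 2) ^ n * ∑ ε : Fin n → Bool, Real.exp (∑ i, boolSign (ε i) * x i) := by
  have h : ∀ i, cosh (x i) = (1 / 2) * ∑ b : Bool, Real.exp (boolSign b * x i) := by
    intro i
    rw [Fintype.sum_bool, cosh_eq]
    simp [boolSign]
    ring
  simp_rw [h, Finset.prod_mul_distrib, Finset.prod_univ_sum, Fintype.piFinset_univ, Real.exp_sum]
  simp

lemma T_signs {n : ℕ} (ε : Fin n → Bool) (x : Fin n → ℝ) :
    T n (fun i => boolSign (ε i) * x i) = T n x := by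
  simp [T, mul_pow, boolSign_sq]

/-- The average of `weight` over all sign changes of the coordinates. -/
noncomputable def symWeight (n : ℕ) (x : Fin n → ℝ) : ℝ :=
  (1 / 2) ^ n * ∑ ε : Fin n → Bool, weight n (fun i => boolSign (ε i) * x i)

lemma symWeight_of_not_pos {n : ℕ} {x : Fin n → ℝ} (hx : ¬ 0 < T n x) : symWeight n x = 0 := by
  simp [symWeight, weight, T_signs, hx]

lemma measurable_weight (n : ℕ) : Measurable (weight n) := by
  unfold weight
  have hT : Measurable (T n) := by unfold T; fun_prop
  have hS : Measurable (S n) := by unfold S; fun_prop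
  exact Measurable.ite (measurableSet_lt measurable_const hT) (by fun_prop) measurable_const

lemma measurable_symWeight (n : ℕ) : Measurable (symWeight n) := by
  unfold symWeight
  refine (Finset.measurable_sum _ fun ε _ => ?_).const_mul _
  exact (measurable_weight n).comp (by fun_prop)

lemma weight_nonneg (n : ℕ) (x : Fin n → ℝ) : 0 ≤ weight n x := by
  unfold weight
  split_ifs
  · exact (Real.exp_pos _).le
  · exact le_rfl

lemma weight_le (n : ℕ) (x : Fin n → ℝ) : weight n x ≤ Real.exp (n / 2) := by
  unfold weight
  split_ifs with h
  · rw [Real.exp_le_exp, div_le_div_iff₀ (by positivity) (by norm_num)]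
    have hCS : S n x ^ 2 ≤ n * T n x := by
      simpa [S, T] using sq_sum_le_card_mul_sum_sq (s := Finset.univ) (f := x)
    linarith
  · exact (Real.exp_pos _).le

lemma integrable_weight {n : ℕ} (μ : Measure (Fin n → ℝ)) [IsFiniteMeasure μ] :
    Integrable (weight n) μ := by
  refine Integrable.of_bound (measurable_weight n).aestronglyMeasurable (Real.exp (n / 2))
    (ae_of_all _ fun x => ?_)
  rw [Real.norm_of_nonneg (weight_nonneg n x)]
  exact weight_le n x

lemma measurePreserving_boolSign_mul {ρ : Measure ℝ} (hsymm : ρ.map (fun x => -x) = ρ)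
    (b : Bool) : MeasurePreserving (fun x => boolSign b * x) ρ ρ := by
  cases b
  · refine ⟨by fun_prop, ?_⟩
    simpa [boolSign] using hsymm
  · have h : (fun x => boolSign true * x) = id := by
      ext x
      simp [boolSign]
    rw [h]
    exact MeasurePreserving.id ρ

lemma integral_symWeight {ρ : Measure ℝ} [IsProbabilityMeasure ρ]
    (hsymm : ρ.map (fun x => -x) = ρ) (n : ℕ) :
    ∫ x, symWeight n x ∂(Measure.pi fun _ : Fin n => ρ) = Z ρ n := by
  have hmp : ∀ ε : Fin n → Bool, MeasurePreserving
      (fun (x : Fin n → ℝ) i => boolSign (ε i) * x i)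
      (Measure.pi fun _ : Fin n => ρ) (Measure.pi fun _ : Fin n => ρ) := fun ε =>
    measurePreserving_pi _ _ fun i => measurePreserving_boolSign_mul hsymm (ε i)
  have hint : ∀ ε : Fin n → Bool,
      ∫ x, weight n (fun i => boolSign (ε i) * x i) ∂(Measure.pi fun _ : Fin n => ρ) = Z ρ n := by
    intro ε
    rw [Z, ← (hmp ε).map_eq, integral_map (hmp ε).measurable.aemeasurable
      (measurable_weight n).aestronglyMeasurable, (hmp ε).map_eq]
  unfold symWeight
  rw [integral_const_mul, integral_finsetSum]
  · simp [hint]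
  · exact fun ε _ => (hmp ε).integrable_comp_of_integrable (integrable_weight _)

lemma integral_exp_neg_sum_coshGap {n : ℕ} {x : Fin n → ℝ} (hT : 0 < T n x) :
    ∫ u : ℝ, Real.exp (-∑ i, coshGap (u * (x i / √(T n x)))) = √(2 * π) * symWeight n x := by
  have hsq : √(T n x) ^ 2 = T n x := Real.sq_sqrt hT.le
  have hpt : ∀ u : ℝ, Real.exp (-∑ i, coshGap (u * (x i / √(T n x)))) =
      (1 / 2) ^ n * ∑ ε : Fin n → Bool,
        Real.exp (-(u ^ 2 / 2) + u * (S n (fun i => boolSign (ε i) * x i) / √(T n x))) := by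
    intro u
    have h1 : ∑ i, (u * (x i / √(T n x))) ^ 2 / 2 = u ^ 2 / 2 := by
      simp_rw [mul_pow, div_pow, hsq]
      rw [← Finset.sum_div, ← Finset.mul_sum, ← Finset.sum_div]
      change u ^ 2 * (T n x / T n x) / 2 = _
      rw [div_self hT.ne', mul_one]
    rw [← Finset.sum_neg_distrib, Real.exp_sum]
    simp_rw [exp_neg_coshGap]
    rw [Finset.prod_mul_distrib, ← Real.exp_sum, Finset.sum_neg_distrib, h1, prod_cosh_eq,
      mul_left_comm, Finset.mul_sum]
    congr 1
    refine Finset.sum_congr rfl fun ε _ => ?_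
    rw [← Real.exp_add, S, Finset.sum_div, Finset.mul_sum]
    congr 2
    exact Finset.sum_congr rfl fun i _ => by ring
  simp_rw [hpt]
  rw [integral_const_mul, integral_finsetSum _ fun ε _ => integrable_exp_neg_sq_add_mul _]
  simp_rw [integral_exp_neg_sq_add_mul]
  rw [symWeight, ← Finset.mul_sum, mul_left_comm]
  congr 2
  refine Finset.sum_congr rfl fun ε _ => ?_
  rw [weight, T_signs, if_pos hT, div_pow, hsq]
  congr 1
  field_simp

/-- The scale `n^{1/4} / √Tₙ` of the rescaled coordinates. -/
noncomputable def scale (n : ℕ) (x : Fin n → ℝ) : ℝ := (n : ℝ) ^ (1 / 4 : ℝ) / √(T n x)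

lemma scale_nonneg (n : ℕ) (x : Fin n → ℝ) : 0 ≤ scale n x := by
  unfold scale
  positivity

lemma scale_pow_four {n : ℕ} {x : Fin n → ℝ} (hT : 0 < T n x) :
    scale n x ^ 4 = n / T n x ^ 2 := by
  rw [scale, div_pow, show √(T n x) ^ 4 = (√(T n x) ^ 2) ^ 2 by ring, Real.sq_sqrt hT.le,
    ← Real.rpow_natCast, ← Real.rpow_mul (Nat.cast_nonneg n)]
  norm_num

lemma integral_rescaled {n : ℕ} (hn : 0 < n) {x : Fin n → ℝ} (hT : 0 < T n x) :
    ∫ z : ℝ, Real.exp (-∑ i, coshGap (z * scale n x * x i)) =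
      √(2 * π) * symWeight n x / (n : ℝ) ^ (1 / 4 : ℝ) := by
  have hp : 0 < (n : ℝ) ^ (1 / 4 : ℝ) := by positivity
  rw [← integral_exp_neg_sum_coshGap hT]
  have h := Measure.integral_comp_mul_left
    (fun u : ℝ => Real.exp (-∑ i, coshGap (u * (x i / √(T n x))))) ((n : ℝ) ^ (1 / 4 : ℝ))
  rw [abs_of_pos (inv_pos.2 hp), smul_eq_mul, mul_comm, ← div_eq_mul_inv] at h
  rw [← h]
  congr! 5 with z i
  rw [scale]
  ring_nf

lemma rescaled_le {n : ℕ} (hn : 0 < n) {x : Fin n → ℝ} (hT : 0 < T n x) (z : ℝ) :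
    Real.exp (-∑ i, coshGap (z * scale n x * x i)) ≤
      Real.exp (1 / 12) * Real.exp (-(1 / 12) * z ^ 2) := by
  rw [← Real.exp_add, Real.exp_le_exp]
  refine (neg_le_neg (le_sum_coshGap _)).trans ?_
  set a := ∑ i, (z * scale n x * x i) ^ 2 with ha
  have hn1 : (1 : ℝ) ≤ n := by exact_mod_cast hn
  have ha0 : 0 ≤ a := Finset.sum_nonneg fun i _ => sq_nonneg _
  have ha2 : a ^ 2 = n * z ^ 4 := by
    have : a = z ^ 2 * scale n x ^ 2 * T n x := by
      rw [ha, T, Finset.mul_sum]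
      exact Finset.sum_congr rfl fun i _ => by ring
    rw [this, show (z ^ 2 * scale n x ^ 2 * T n x) ^ 2
      = z ^ 4 * scale n x ^ 4 * T n x ^ 2 by ring, scale_pow_four hT]
    field_simp
  have han : a ≤ n * z ^ 2 := by
    refine abs_le_of_sq_le_sq' ?_ (by positivity) |>.2
    rw [ha2]
    nlinarith [mul_nonneg (sub_nonneg.2 hn1) (pow_nonneg (sq_nonneg z) 2)]
  have key : (z ^ 2 - 1) / 12 ≤ a ^ 2 / (12 * (n + a)) := by
    rw [div_le_div_iff₀ (by norm_num) (by positivity), ha2]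
    rcases le_or_gt (z ^ 2) 1 with hz | hz
    · have : 0 ≤ (n : ℝ) * z ^ 4 * 12 := by positivity
      have : (z ^ 2 - 1) * (12 * (n + a)) ≤ 0 :=
        mul_nonpos_of_nonpos_of_nonneg (by linarith) (by positivity)
      linarith
    · nlinarith [mul_le_mul_of_nonneg_left han (sub_nonneg.2 hz.le)]
  linarith

lemma integrable_dominating :
    Integrable fun z : ℝ => Real.exp (1 / 12) * Real.exp (-(1 / 12) * z ^ 2) :=
  (integrable_exp_neg_mul_sq (by norm_num)).const_mul _

lemma continuous_rescaled {n : ℕ} (x : Fin n → ℝ) :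
    Continuous fun z : ℝ => Real.exp (-∑ i, coshGap (z * scale n x * x i)) := by
  have := continuous_coshGap
  fun_prop

lemma symWeight_nonneg (n : ℕ) (x : Fin n → ℝ) : 0 ≤ symWeight n x :=
  mul_nonneg (by positivity) (Finset.sum_nonneg fun _ _ => weight_nonneg n _)

lemma normalized_symWeight_le {n : ℕ} (hn : 0 < n) (x : Fin n → ℝ) :
    √(2 * π) * symWeight n x / (n : ℝ) ^ (1 / 4 : ℝ) ≤
      ∫ z : ℝ, Real.exp (1 / 12) * Real.exp (-(1 / 12) * z ^ 2) := by
  by_cases hT : 0 < T n x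
  · rw [← integral_rescaled hn hT]
    refine integral_mono (integrable_dominating.mono'
      (continuous_rescaled x).aestronglyMeasurable (ae_of_all _ fun z => ?_))
      integrable_dominating (rescaled_le hn hT)
    rw [Real.norm_of_nonneg (Real.exp_pos _).le]
    exact rescaled_le hn hT z
  · rw [symWeight_of_not_pos hT]
    simp only [mul_zero, zero_div]
    exact integral_nonneg fun z => by positivity

lemma abs_sum_coshGap_sub_le {n : ℕ} (a : Fin n → ℝ) :
    |∑ i, coshGap (a i) - (∑ i, a i ^ 4) / 12| ≤ (∑ i, |a i| ^ 5) / 24 := by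
  rw [Finset.sum_div, Finset.sum_div, ← Finset.sum_sub_distrib]
  refine (Finset.abs_sum_le_sum_abs _ _).trans (Finset.sum_le_sum fun i _ => ?_)
  have h1 := coshGap_le (a i)
  have h2 := sub_le_coshGap (a i)
  rw [abs_of_nonpos (by linarith)]
  linarith

/-- Deterministic form of the limit, along a sequence with converging empirical moments. -/
lemma tendsto_normalized_symWeight {ω : ℕ → ℝ} {s2 m4 m5 : ℝ} (hs2 : 0 < s2)
    (h2 : Tendsto (fun n : ℕ => (∑ i ∈ Finset.range n, ω i ^ 2) / n) atTop (𝓝 s2))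
    (h4 : Tendsto (fun n : ℕ => (∑ i ∈ Finset.range n, ω i ^ 4) / n) atTop (𝓝 m4))
    (h5 : Tendsto (fun n : ℕ => (∑ i ∈ Finset.range n, |ω i| ^ 5) / n) atTop (𝓝 m5)) :
    Tendsto (fun n : ℕ => √(2 * π) * symWeight n (fun i : Fin n => ω i) / (n : ℝ) ^ (1 / 4 : ℝ))
      atTop (𝓝 (∫ z : ℝ, Real.exp (-(m4 * z ^ 4 / (12 * s2 ^ 2))))) := by
  set x : (n : ℕ) → Fin n → ℝ := fun n i => ω i with hx
  have hTx : ∀ n, T n (x n) = ∑ i ∈ Finset.range n, ω i ^ 2 := fun n =>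
    Fin.sum_univ_eq_sum_range (fun i => ω i ^ 2) n
  have hev : ∀ᶠ n : ℕ in atTop, 0 < n ∧ 0 < T n (x n) := by
    filter_upwards [h2.eventually (lt_mem_nhds hs2), eventually_gt_atTop 0] with n hn hn0
    have : (0 : ℝ) < n := by exact_mod_cast hn0
    rw [← hTx] at hn
    exact ⟨hn0, (div_pos_iff_of_pos_right this).1 hn⟩
  have hscaled : ∀ {f : ℕ → ℝ} {l : ℝ},
      Tendsto (fun n : ℕ => (∑ i ∈ Finset.range n, f i) / n) atTop (𝓝 l) →
      Tendsto (fun n : ℕ => scale n (x n) ^ 4 * ∑ i : Fin n, f i) atTop (𝓝 (l / s2 ^ 2)) := by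
    intro f l hf
    refine (hf.div (h2.pow 2) (by positivity)).congr' ?_
    filter_upwards [hev] with n hn
    have hn0 : (n : ℝ) ≠ 0 := by exact_mod_cast hn.1.ne'
    have hT0 := hn.2.ne'
    rw [scale_pow_four hn.2, Fin.sum_univ_eq_sum_range (fun i => f i) n]
    simp only [Pi.div_apply, ← hTx]
    field_simp
  have hscale : Tendsto (fun n : ℕ => scale n (x n)) atTop (𝓝 0) := by
    have h : Tendsto (fun n : ℕ => scale n (x n) ^ 4) atTop (𝓝 0) := by
      have := tendsto_one_div_atTop_nhds_zero_nat.div (h2.pow 2) (by positivity)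
      rw [zero_div] at this
      refine this.congr' ?_
      filter_upwards [hev] with n hn
      have hn0 : (n : ℝ) ≠ 0 := by exact_mod_cast hn.1.ne'
      have hT0 := hn.2.ne'
      rw [scale_pow_four hn.2]
      simp only [Pi.div_apply, ← hTx]
      field_simp
    have h' := (h.sqrt).sqrt
    simp only [Real.sqrt_zero] at h'
    refine h'.congr fun n => ?_
    have hs := scale_nonneg n (x n)
    rw [show scale n (x n) ^ 4 = (scale n (x n) ^ 2) ^ 2 by ring, Real.sqrt_sq (by positivity),
      Real.sqrt_sq hs]
  have hpt : ∀ z : ℝ, Tendsto (fun n : ℕ => ∑ i, coshGap (z * scale n (x n) * x n i)) atTop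
      (𝓝 (m4 * z ^ 4 / (12 * s2 ^ 2))) := by
    intro z
    have hmain : Tendsto (fun n : ℕ => (∑ i, (z * scale n (x n) * x n i) ^ 4) / 12) atTop
        (𝓝 (m4 * z ^ 4 / (12 * s2 ^ 2))) := by
      convert (hscaled h4).const_mul (z ^ 4 / 12) using 2 with n
      · rw [Finset.mul_sum, Finset.mul_sum, Finset.sum_div]
        exact Finset.sum_congr rfl fun i _ => by simp only [hx]; ring
      · ring
    have herr : Tendsto (fun n : ℕ => (∑ i, |z * scale n (x n) * x n i| ^ 5) / 24) atTop
        (𝓝 0) := by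
      convert (hscale.mul (hscaled h5)).const_mul (|z| ^ 5 / 24) using 2 with n
      · rw [Finset.mul_sum, Finset.mul_sum, Finset.mul_sum, Finset.sum_div]
        refine Finset.sum_congr rfl fun i _ => ?_
        rw [abs_mul, abs_mul, abs_of_nonneg (scale_nonneg n (x n))]
        ring
      · ring
    have hdiff := squeeze_zero_norm
      (f := fun n => ∑ i, coshGap (z * scale n (x n) * x n i) -
        (∑ i, (z * scale n (x n) * x n i) ^ 4) / 12)
      (fun n => abs_sum_coshGap_sub_le fun i => z * scale n (x n) * x n i) herr
    simpa using hdiff.add hmain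
  have hint : Tendsto
      (fun n : ℕ => ∫ z : ℝ, Real.exp (-∑ i, coshGap (z * scale n (x n) * x n i))) atTop
      (𝓝 (∫ z : ℝ, Real.exp (-(m4 * z ^ 4 / (12 * s2 ^ 2))))) := by
    refine tendsto_integral_filter_of_dominated_convergence _
      (Eventually.of_forall fun n => (continuous_rescaled (x n)).aestronglyMeasurable)
      ?_ integrable_dominating (ae_of_all _ fun z => ?_)
    · filter_upwards [hev] with n hn
      refine ae_of_all _ fun z => ?_
      rw [Real.norm_of_nonneg (Real.exp_pos _).le]
      exact rescaled_le hn.1 hn.2 z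
    · exact (Real.continuous_exp.tendsto _).comp (hpt z).neg
  refine hint.congr' ?_
  filter_upwards [hev] with n hn
  exact integral_rescaled hn.1 hn.2

lemma map_infinitePi_eq_pi (ρ : Measure ℝ) [IsProbabilityMeasure ρ] (n : ℕ) :
    (Measure.infinitePi fun _ : ℕ => ρ).map (fun ω (i : Fin n) => ω i) =
      Measure.pi fun _ : Fin n => ρ := by
  have hind := (ProbabilityTheory.iIndepFun_infinitePi (P := fun _ : ℕ => ρ)
    (X := fun _ x => x) (fun _ => measurable_id)).precomp (Fin.val_injective (n := n))
  have h := (ProbabilityTheory.iIndepFun_iff_map_fun_eq_pi_map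
    (f := fun (i : Fin n) (ω : ℕ → ℝ) => ω i)
    (fun i => (measurable_pi_apply (i : ℕ)).aemeasurable)).1 hind
  simpa only [Measure.infinitePi_map_eval] using h

lemma strong_law_infinitePi (ρ : Measure ℝ) [IsProbabilityMeasure ρ] {f : ℝ → ℝ}
    (hf : Measurable f) (hint : Integrable f ρ) :
    ∀ᵐ ω ∂(Measure.infinitePi fun _ : ℕ => ρ),
      Tendsto (fun n : ℕ => (∑ i ∈ Finset.range n, f (ω i)) / n) atTop (𝓝 (∫ y, f y ∂ρ)) := by
  have hmap := fun i => Measure.infinitePi_map_eval (fun _ : ℕ => ρ) i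
  have hmp : ∀ i, MeasurePreserving (fun ω : ℕ → ℝ => ω i)
      (Measure.infinitePi fun _ : ℕ => ρ) ρ := fun i => ⟨measurable_pi_apply i, hmap i⟩
  have hind := ProbabilityTheory.iIndepFun_infinitePi (P := fun _ : ℕ => ρ)
    (X := fun _ => f) (fun _ => hf)
  have h := ProbabilityTheory.strong_law_ae_real (fun i (ω : ℕ → ℝ) => f (ω i))
    ((hmp 0).integrable_comp_of_integrable hint)
    (fun i j hij => hind.indepFun hij)
    (fun i => ⟨(hf.comp (measurable_pi_apply i)).aemeasurable,
      (hf.comp (measurable_pi_apply 0)).aemeasurable, by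
        change Measure.map (f ∘ fun ω : ℕ → ℝ => ω i) _ = Measure.map (f ∘ fun ω : ℕ → ℝ => ω 0) _
        rw [← Measure.map_map hf (measurable_pi_apply i),
          ← Measure.map_map hf (measurable_pi_apply 0), hmap, hmap]⟩)
  have hE : ∫ ω, f (ω 0) ∂(Measure.infinitePi fun _ : ℕ => ρ) = ∫ y, f y ∂ρ := by
    conv_rhs => rw [← hmap 0]
    rw [integral_map (measurable_pi_apply 0).aemeasurable hf.aestronglyMeasurable]
  rwa [hE] at h

lemma integral_id_eq_zero_of_symm {ρ : Measure ℝ} (hsymm : ρ.map (fun x => -x) = ρ) :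
    ∫ x, x ∂ρ = 0 := by
  have h : ∫ x, x ∂ρ = ∫ x, -x ∂ρ := by
    conv_lhs => rw [← hsymm]
    exact integral_map measurable_neg.aemeasurable measurable_id.aestronglyMeasurable
  rw [integral_neg] at h
  linarith

lemma integrable_pow_of_integrable_abs_pow {ρ : Measure ℝ} [IsFiniteMeasure ρ] {k m : ℕ}
    (hkm : k ≤ m) (h : Integrable (fun x : ℝ => |x| ^ m) ρ) :
    Integrable (fun x : ℝ => x ^ k) ρ := by
  refine ((integrable_const (1 : ℝ)).add h).mono' (by fun_prop) (ae_of_all _ fun x => ?_)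
  rw [norm_pow, Real.norm_eq_abs]
  simp only [Pi.add_apply]
  rcases le_total |x| 1 with hx | hx
  · linarith [pow_le_one₀ (n := k) (abs_nonneg x) hx, pow_nonneg (abs_nonneg x) m]
  · linarith [pow_le_pow_right₀ hx hkm]

lemma integral_sq_pos {ρ : Measure ℝ} [IsProbabilityMeasure ρ] (hne : ρ ≠ Measure.dirac 0)
    (hint : Integrable (fun x : ℝ => x ^ 2) ρ) : 0 < ∫ x, x ^ 2 ∂ρ := by
  refine lt_of_le_of_ne (integral_nonneg fun x => sq_nonneg x) fun h => hne ?_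
  have h0 := (integral_eq_zero_iff_of_nonneg (fun x : ℝ => sq_nonneg x) hint).1 h.symm
  have h1 : (id : ℝ → ℝ) =ᵐ[ρ] fun _ => 0 := by
    filter_upwards [h0] with x hx
    simpa using hx
  rw [← Measure.map_id (μ := ρ), Measure.map_congr h1, Measure.map_const]
  simp

/-- if `ρ` is a symmetric probability measure on `ℝ`, not the Dirac mass
at `0`, with a finite fifth moment, variance `σ²` and fourth moment `μ₄`, then
`√(2π) Zₙ / n^{1/4} → ∫_ℝ exp(−μ₄ z⁴/(12σ⁴)) dz` as `n → ∞`; equivalently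
`Zₙ ∼ n^{1/4} (2π)^{−1/2} (3σ⁴/(4μ₄))^{1/4} Γ(1/4)`. -/
theorem normalization_asymptotics
    (ρ : Measure ℝ) [IsProbabilityMeasure ρ]
    (hsymm : ρ.map (fun x => -x) = ρ)
    (hne : ρ ≠ Measure.dirac 0)
    (h5 : Integrable (fun x : ℝ => |x| ^ 5) ρ)
    (σ2 μ4 : ℝ)
    (hσ2 : σ2 = ProbabilityTheory.variance id ρ)
    (hμ4 : μ4 = ∫ x : ℝ, x ^ 4 ∂ρ) :
    Tendsto (fun n : ℕ => Real.sqrt (2 * π) * Z ρ n / (n : ℝ) ^ (1/4 : ℝ))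
      atTop (𝓝 (∫ z : ℝ, Real.exp (-(μ4 * z ^ 4 / (12 * σ2 ^ 2))))) := by
  have h2 := integrable_pow_of_integrable_abs_pow (k := 2) (by norm_num) h5
  have h4 := integrable_pow_of_integrable_abs_pow (k := 4) (by norm_num) h5
  have hvar : σ2 = ∫ x, x ^ 2 ∂ρ := by
    rw [hσ2, ProbabilityTheory.variance_of_integral_eq_zero aemeasurable_id
      (integral_id_eq_zero_of_symm hsymm)]
    rfl
  have hpos : 0 < σ2 := hvar ▸ integral_sq_pos hne h2
  set P := Measure.infinitePi fun _ : ℕ => ρ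
  have hproj : ∀ n : ℕ, Measurable fun (ω : ℕ → ℝ) (i : Fin n) => ω i := fun n =>
    measurable_pi_lambda _ fun i => measurable_pi_apply (i : ℕ)
  have hZ : ∀ n : ℕ, √(2 * π) * Z ρ n / (n : ℝ) ^ (1 / 4 : ℝ) =
      ∫ ω, √(2 * π) * symWeight n (fun i : Fin n => ω i) / (n : ℝ) ^ (1 / 4 : ℝ) ∂P := by
    intro n
    rw [integral_div, integral_const_mul, ← integral_symWeight hsymm, ← map_infinitePi_eq_pi,
      integral_map
        (hproj n).aemeasurable (measurable_symWeight n).aestronglyMeasurable]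
  simp_rw [hZ]
  have hlim : Tendsto (fun n : ℕ =>
      ∫ ω, √(2 * π) * symWeight n (fun i : Fin n => ω i) / (n : ℝ) ^ (1 / 4 : ℝ) ∂P) atTop
      (𝓝 (∫ _ω, (∫ z : ℝ, Real.exp (-(μ4 * z ^ 4 / (12 * σ2 ^ 2)))) ∂P)) := by
    refine tendsto_integral_filter_of_dominated_convergence
      (fun _ => ∫ z : ℝ, Real.exp (1 / 12) * Real.exp (-(1 / 12) * z ^ 2))
      (Eventually.of_forall fun n => ?_) ?_ (integrable_const _) ?_
    · have := (measurable_symWeight n).comp (hproj n)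
      exact ((this.const_mul _).div_const _).aestronglyMeasurable
    · filter_upwards [eventually_gt_atTop 0] with n hn
      refine ae_of_all _ fun ω => ?_
      have := symWeight_nonneg n (fun i : Fin n => ω i)
      rw [Real.norm_of_nonneg (by positivity)]
      exact normalized_symWeight_le hn _
    · filter_upwards [strong_law_infinitePi ρ (by fun_prop) h2,
        strong_law_infinitePi ρ (by fun_prop) h4,
        strong_law_infinitePi ρ (by fun_prop) h5] with ω l2 l4 l5
      rw [← hvar] at l2
      rw [← hμ4] at l4
      exact tendsto_normalized_symWeight hpos l2 l4 l5
  simpa using hlim
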